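/- Let v, w be words over A = {a,b}. If λ_v(w) is a Christoffel word, then w is a Christoffel word. -/

import Mathlib

namespace Chri

/-- Length of the longest palindromic suffix of `w`. -/
def lpsLen (w : List Bool) : ℕ :=
  ((List.range (w.length + 1)).filter
    (fun l => w.drop (w.length - l) == (w.drop (w.length - l)).reverse)).foldr max 0

/-- Right palindromic closure: the shortest palindrome having `w` as a prefix. -/
def palClosure (w : List Bool) : List Bool :=
  w ++ (w.take (w.length - lpsLen w)).reverse

/-- The iterated palindromization map ψ. -/
def psi (v : List Bool) : List Bool :=
  v.foldl (fun w x => palClosure (w ++ [x])) []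

/-- Apply a substitution (morphism of the free monoid) letter by letter. -/
def applyM (f : Bool → List Bool) (w : List Bool) : List Bool := (w.map f).flatten

/-- μ_x : x ↦ x, y ↦ xy (a = false, b = true). -/
def muL (x : Bool) : List Bool → List Bool :=
  applyM (fun y => if y = x then [x] else [x, y])

/-- λ_a = μ_a; λ_b : a ↦ ab, b ↦ b. -/
def lamL : Bool → List Bool → List Bool
  | false => applyM (fun y => if y = false then [false] else [false, true])
  | true  => applyM (fun y => if y = true then [true] else [false, true])

/-- μ_{v₁⋯v_n} = μ_{v₁} ∘ ⋯ ∘ μ_{v_n}. -/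
def muW : List Bool → List Bool → List Bool
  | [], w => w
  | x :: v, w => muL x (muW v w)

/-- λ_{v₁⋯v_n} = λ_{v₁} ∘ ⋯ ∘ λ_{v_n}. -/
def lamW : List Bool → List Bool → List Bool
  | [], w => w
  | x :: v, w => lamL x (lamW v w)

/-- Christoffel words: the letters and the words aψ(v)b. -/
def IsChristoffel (w : List Bool) : Prop :=
  w = [false] ∨ w = [true] ∨ ∃ v, w = false :: (psi v ++ [true])

/-- A word is constant if it is a power of a single letter. -/
def IsConstant (v : List Bool) : Prop := ∃ x n, v = List.replicate n x

/-- ₊v : the longest proper suffix of v immediately preceded by the complement of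
the first letter of v. -/
def plusV (v : List Bool) : List Bool :=
  (v.dropWhile (fun y => y == v.headD false)).tail

/-- v₊ : the longest proper prefix of v immediately followed by the complement of
the last letter of v. -/
def vPlus (v : List Bool) : List Bool := (plusV v.reverse).reverse

/-- α₀: the length of the first maximal block of `v` (the index). -/
def blockLen (v : List Bool) : ℕ :=
  (v.takeWhile (fun y => y == v.headD false)).length

/-- The list of lengths of the maximal blocks of equal letters of `v`
(the integral representation (α₀, …, α_n)). -/
def blockLens : List Bool → List ℕ
  | [] => []
  | [_] => [1]
  | x :: y :: v =>
    if x = y then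
      match blockLens (y :: v) with
      | [] => [1]
      | n :: ns => (n + 1) :: ns
    else 1 :: blockLens (y :: v)

/-- ext(v) = number of maximal blocks of v. -/
def ext (v : List Bool) : ℕ := (blockLens v).length

/-- π(w): the minimal period of `w` (with π(ε) = 1). -/
noncomputable def minPeriod (w : List Bool) : ℕ :=
  sInf {p | 0 < p ∧ ∀ i, i + p < w.length → w.getD i false = w.getD (i + p) false}

/-- φ_k : a ↦ a^{k+1} b, b ↦ a^k b. -/
def phi (k : ℕ) : List Bool → List Bool :=
  applyM (fun y => if y = false then List.replicate (k + 1) false ++ [true]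
                   else List.replicate k false ++ [true])

/-- φ̂_k : a ↦ a b^k, b ↦ a b^{k+1}. -/
def phiHat (k : ℕ) : List Bool → List Bool :=
  applyM (fun y => if y = false then false :: List.replicate k true
                   else false :: List.replicate (k + 1) true)

attribute [local instance] Classical.propDecidable

/-- The derivative ∂w of a proper Christoffel word w = aψ(v)b of index k:
∂(ab) = a, and otherwise the preimage of w under φ_k (if v starts with a)
or φ̂_k (if v starts with b). -/
noncomputable def derivC (w : List Bool) : List Bool :=
  if w = [false, true] then [false]
  else if h : ∃ v, v ≠ [] ∧ w = false :: (psi v ++ [true]) then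
    if h.choose.headD false = false then Function.invFun (phi (blockLen h.choose)) w
    else Function.invFun (phiHat (blockLen h.choose)) w
  else w

/-- The depth of a Christoffel word: the least d with ∂^d w a single letter. -/
noncomputable def depth (w : List Bool) : ℕ :=
  sInf {d | derivC^[d] w = [false] ∨ derivC^[d] w = [true]}

/-- The height h(v): the least n ≥ 1 such that v_(n) is constant, where
v_(1) = v and v_(n+1) = ₊(v_(n)). -/
noncomputable def height (v : List Bool) : ℕ :=
  sInf {n | 0 < n ∧ IsConstant (plusV^[n - 1] v)}

/-- Helper computing δ_i from (α_{i-1}, δ_{i-1}) along the remaining exponents. -/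
def ruleAux : ℕ → ℕ → List ℕ → List ℕ
  | _, _, [] => []
  | pa, pd, a :: rest =>
    let d := if 1 < a then 1 else if 1 < pa then 0 else 1 - pd
    d :: ruleAux a d rest

/-- The sequence δ₀, δ₁, …, δ_n computed by the recursive rule (δ₀ = 1). -/
def ruleSeq : List ℕ → List ℕ
  | [] => []
  | a :: rest => 1 :: ruleAux a 1 rest

/-- δ(v) = Σ_{i=0}^n δ_i(v), where additionally δ_n(v) = 1; δ(ε) = 1. -/
def delta (v : List Bool) : ℕ := ((ruleSeq (blockLens v)).dropLast).sum + 1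

/-- |u₁|: length of the longest prefix x₀⋯x_i of u with i < n and α₀ = ⋯ = α_i = 1
(and 0 if α₀ > 1 or n = 0). -/
def u1len (u : List Bool) : ℕ :=
  min ((blockLens u).takeWhile (fun n => n == 1)).length ((blockLens u).length - 1)

/-- |u₂|: the symmetric notion for suffixes. -/
def u2len (u : List Bool) : ℕ := u1len u.reverse

/-- The sequence H: H(1) = 0, H(2n) = H(n), H(4n±1) = H(n)+1. -/
def H : ℕ → ℕ
  | 0 => 0
  | 1 => 0
  | n + 2 =>
    if (n + 2) % 2 = 0 then H ((n + 2) / 2)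
    else if (n + 2) % 4 = 1 then H ((n + 2) / 4) + 1
    else H ((n + 3) / 4) + 1
decreasing_by all_goals omega

/-- ⟨w⟩: the word w read as an integer in base 2 (a = 0, b = 1). -/
def wordVal (w : List Bool) : ℕ :=
  w.foldl (fun acc x => 2 * acc + (if x then 1 else 0)) 0

/-- Membership in X^*: w is a concatenation of words of X. -/
def InStar (X : Set (List Bool)) (w : List Bool) : Prop :=
  ∃ l : List (List Bool), (∀ u ∈ l, u ∈ X) ∧ w = l.flatten

/-- w ∈ x⁺. -/
def PowPos (x : Bool) (w : List Bool) : Prop := ∃ k, 0 < k ∧ w = List.replicate k x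

/-- `u = s ++ q`, where `q` is the longest palindromic suffix of `u`. -/
def IsLPS (u s q : List Bool) : Prop :=
  u = s ++ q ∧ q.reverse = q ∧
    ∀ s' q' : List Bool, u = s' ++ q' → q'.reverse = q' → q'.length ≤ q.length

theorem exists_isLPS (u : List Bool) : ∃ s q, IsLPS u s q := by
  classical
  have hex : ∃ n, ∃ s q : List Bool, u = s ++ q ∧ q.reverse = q ∧ s.length = n :=
    ⟨_, u, [], by simp, rfl, rfl⟩
  obtain ⟨s, q, hu, hq, hn⟩ := Nat.find_spec hex
  refine ⟨s, q, hu, hq, fun s' q' hu' hq' => ?_⟩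
  have hmin := Nat.find_min' hex ⟨s', q', hu', hq', rfl⟩
  have hlen : (s ++ q).length = (s' ++ q').length := by rw [← hu, ← hu']
  simp only [List.length_append] at hlen
  omega

theorem le_foldr_max {l : List ℕ} {a : ℕ} (h : a ∈ l) : a ≤ l.foldr max 0 := by
  induction l with
  | nil => simp at h
  | cons b l ih =>
    rcases List.mem_cons.1 h with rfl | h
    · exact le_max_left _ _
    · exact (ih h).trans (le_max_right _ _)

theorem foldr_max_le {l : List ℕ} {b : ℕ} (h : ∀ a ∈ l, a ≤ b) : l.foldr max 0 ≤ b := by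
  induction l with
  | nil => simp
  | cons a l ih =>
    exact max_le (h a (by simp)) (ih fun c hc => h c (by simp [hc]))

theorem IsLPS.lpsLen_eq {u s q : List Bool} (h : IsLPS u s q) : lpsLen u = q.length := by
  obtain ⟨rfl, hq, hmax⟩ := h
  apply le_antisymm
  · refine foldr_max_le fun a ha => ?_
    obtain ⟨ha, hpal⟩ := List.mem_filter.1 ha
    have hle := hmax _ _ (List.take_append_drop ((s ++ q).length - a) (s ++ q)).symm
      (eq_of_beq hpal).symm
    rw [List.length_drop] at hle
    have := List.mem_range.1 ha
    omega
  · refine le_foldr_max (List.mem_filter.2 ⟨List.mem_range.2 (by simp), ?_⟩)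
    simp [hq]

theorem IsLPS.palClosure_eq {u s q : List Bool} (h : IsLPS u s q) :
    palClosure u = s ++ q ++ s.reverse := by
  rw [palClosure, h.lpsLen_eq, h.1]
  simp

@[simp] theorem muL_nil (x : Bool) : muL x [] = [] := rfl

@[simp] theorem muL_append (x : Bool) (u v : List Bool) :
    muL x (u ++ v) = muL x u ++ muL x v := by
  simp [muL, applyM]

theorem muL_cons_self (x : Bool) (u : List Bool) : muL x (x :: u) = x :: muL x u := by
  simp [muL, applyM]

theorem muL_cons_of_ne {x y : Bool} (h : y ≠ x) (u : List Bool) :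
    muL x (y :: u) = x :: y :: muL x u := by
  simp [muL, applyM, h]

theorem exists_muL_append_eq_cons (x : Bool) (u : List Bool) :
    ∃ t, muL x u ++ [x] = x :: t := by
  rcases u with _ | ⟨c, u⟩
  · exact ⟨[], rfl⟩
  · rcases eq_or_ne c x with rfl | hc
    · exact ⟨_, by rw [muL_cons_self]; rfl⟩
    · exact ⟨_, by rw [muL_cons_of_ne hc]; rfl⟩

theorem cons_reverse_muL (x : Bool) (u : List Bool) :
    x :: (muL x u).reverse = muL x u.reverse ++ [x] := by
  induction u with
  | nil => rfl
  | cons c u ih =>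
    rcases eq_or_ne c x with rfl | hc
    · simp only [List.reverse_cons, muL_append, muL_cons_self, muL_nil, ← List.cons_append, ih]
    · simp [muL_cons_of_ne hc, ← List.cons_append, ih]

theorem muL_injective (x : Bool) : Function.Injective (muL x) := by
  intro u
  induction u with
  | nil =>
    rintro (_ | ⟨d, v⟩) h
    · rfl
    · rcases eq_or_ne d x with rfl | hd
      · simp [muL_cons_self] at h
      · simp [muL_cons_of_ne hd] at h
  | cons c u ih =>
    have key : ∀ (y : Bool) (z t : List Bool), y ≠ x → muL x z ≠ y :: t := by
      rintro y (_ | ⟨e, z⟩) t hy h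
      · simp at h
      · rcases eq_or_ne e x with rfl | he
        · rw [muL_cons_self] at h
          exact hy (List.cons.inj h).1.symm
        · rw [muL_cons_of_ne he] at h
          exact hy (List.cons.inj h).1.symm
    rintro (_ | ⟨d, v⟩) h
    · rcases eq_or_ne c x with rfl | hc
      · simp [muL_cons_self] at h
      · simp [muL_cons_of_ne hc] at h
    · rcases eq_or_ne c x with rfl | hc
      · rcases eq_or_ne d c with rfl | hd
        · rw [muL_cons_self, muL_cons_self] at h
          rw [ih (List.cons.inj h).2]
        · rw [muL_cons_self, muL_cons_of_ne hd] at h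
          exact absurd (List.cons.inj h).2 (key _ _ _ hd)
      · rcases eq_or_ne d x with rfl | hd
        · rw [muL_cons_of_ne hc, muL_cons_self] at h
          exact absurd (List.cons.inj h).2.symm (key _ _ _ hc)
        · rw [muL_cons_of_ne hc, muL_cons_of_ne hd] at h
          obtain ⟨rfl, h'⟩ := List.cons.inj (List.cons.inj h).2
          rw [ih h']

theorem muL_ne_append_cons_cons {x y : Bool} (hy : y ≠ x) (z a b : List Bool) :
    muL x z ≠ a ++ y :: y :: b := by
  induction z generalizing a with
  | nil => simp
  | cons c z ih =>
    intro hab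
    rcases eq_or_ne c x with rfl | hc
    · rw [muL_cons_self] at hab
      rcases a with _ | ⟨f, a⟩
      · exact hy (List.cons.inj hab).1.symm
      · exact ih a (List.cons.inj hab).2
    · rw [muL_cons_of_ne hc] at hab
      rcases a with _ | ⟨f, _ | ⟨g, a⟩⟩
      · exact hy (List.cons.inj hab).1.symm
      · obtain ⟨r, hr⟩ := exists_muL_append_eq_cons x z
        rw [(List.cons.inj (List.cons.inj hab).2).2] at hr
        exact hy (List.cons.inj hr).1
      · exact ih a (List.cons.inj (List.cons.inj hab).2).2

theorem head_eq_of_palindromic_suffix {d y : Bool} {s t u : List Bool}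
    (h : u ++ [y] = s ++ d :: t) (hp : (d :: t).reverse = d :: t) : d = y := by
  have hlast : (d :: t).getLast? = some y := by
    simpa using (congrArg List.getLast? h).symm
  rw [← List.head?_reverse, hp] at hlast
  simpa using hlast

/-- A suffix of `μ_x(u)x` starting with `x` is of the form `μ_x(q)x` with `q` a suffix of `u`. -/
theorem exists_suffix_of_muL_append {x : Bool} {u s t : List Bool}
    (h : muL x u ++ [x] = s ++ x :: t) :
    ∃ s' q, u = s' ++ q ∧ x :: t = muL x q ++ [x] := by
  induction u generalizing s with
  | nil =>
    rcases s with _ | ⟨d, s⟩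
    · exact ⟨[], [], rfl, h.symm⟩
    · simp at h
  | cons c u ih =>
    have lift : ∀ s₀, muL x u ++ [x] = s₀ ++ x :: t →
        ∃ s' q, c :: u = s' ++ q ∧ x :: t = muL x q ++ [x] := by
      intro s₀ h₀
      obtain ⟨s', q, rfl, hq⟩ := ih h₀
      exact ⟨c :: s', q, rfl, hq⟩
    rcases s with _ | ⟨d, s⟩
    · exact ⟨[], c :: u, rfl, h.symm⟩
    · rcases eq_or_ne c x with rfl | hc
      · rw [muL_cons_self] at h
        exact lift s (List.cons.inj h).2
      · rw [muL_cons_of_ne hc] at h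
        have h' := (List.cons.inj h).2
        rcases s with _ | ⟨e, s⟩
        · exact absurd (List.cons.inj h').1 hc
        · exact lift s (List.cons.inj h').2

theorem reverse_muL_append (x : Bool) (u : List Bool) :
    (muL x u ++ [x]).reverse = muL x u.reverse ++ [x] := by
  rw [← cons_reverse_muL]; simp

theorem IsLPS.muL_append {u s q : List Bool} (h : IsLPS u s q) (x : Bool) :
    IsLPS (muL x u ++ [x]) (muL x s) (muL x q ++ [x]) := by
  obtain ⟨rfl, hq, hmax⟩ := h
  refine ⟨by simp, by rw [reverse_muL_append, hq], fun s' t ht htp => ?_⟩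
  rcases t with _ | ⟨d, t⟩
  · simp
  obtain rfl := head_eq_of_palindromic_suffix ht htp
  obtain ⟨s₁, q₁, hu, hq₁⟩ := exists_suffix_of_muL_append ht
  have hq₁p : q₁.reverse = q₁ := by
    rw [hq₁, reverse_muL_append] at htp
    exact muL_injective d (List.append_cancel_right htp)
  have hsuf : q₁ <:+ q :=
    List.suffix_of_suffix_length_le ⟨s₁, hu.symm⟩ ⟨s, rfl⟩ (hmax _ _ hu hq₁p)
  obtain ⟨r, rfl⟩ := hsuf
  rw [hq₁]
  simp

theorem muL_palClosure {u s q : List Bool} (h : IsLPS u s q) (x : Bool) :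
    muL x (palClosure u) ++ [x] = muL x s ++ (muL x q ++ [x]) ++ (muL x s).reverse := by
  rw [h.palClosure_eq]
  simp [← cons_reverse_muL]

theorem palClosure_muL_append (x : Bool) (u : List Bool) :
    palClosure (muL x u ++ [x]) = muL x (palClosure u) ++ [x] := by
  obtain ⟨s, q, h⟩ := exists_isLPS u
  rw [(h.muL_append x).palClosure_eq, muL_palClosure h]

theorem palClosure_muL_of_ne {x y : Bool} (hy : y ≠ x) (w : List Bool) :
    palClosure (muL x (w ++ [y])) = muL x (palClosure (w ++ [y])) ++ [x] := by
  obtain ⟨s, q, h⟩ := exists_isLPS (w ++ [y])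
  have hq : ∃ q', q = y :: q' := by
    have hlen := h.2.2 w [y] rfl rfl
    rcases q with _ | ⟨d, q⟩
    · simp at hlen
    · exact ⟨q, by rw [head_eq_of_palindromic_suffix h.1 h.2.1]⟩
  obtain ⟨q, rfl⟩ := hq
  have hp := h.muL_append x
  have hmu : muL x (w ++ [y]) = (muL x s ++ [x]) ++ y :: muL x q := by
    rw [h.1]; simp [muL_cons_of_ne hy]
  have hlps : IsLPS (muL x (w ++ [y])) (muL x s ++ [x]) (y :: muL x q) := by
    refine ⟨hmu, ?_, fun s' t ht htp => ?_⟩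
    · have := hp.2.1
      rw [muL_cons_of_ne hy, List.cons_append, List.reverse_cons, List.reverse_append] at this
      exact List.append_cancel_right (List.cons.inj this).2
    · rcases t with _ | ⟨d, t⟩
      · simp
      obtain rfl : d = y := head_eq_of_palindromic_suffix (u := muL x w ++ [x])
        (by rw [← ht]; simp [muL_cons_of_ne hy]) htp
      have hs' : ∃ s'', s' = s'' ++ [x] := by
        rcases List.eq_nil_or_concat s' with rfl | ⟨s'', e, rfl⟩
        · obtain ⟨r, hr⟩ := exists_muL_append_eq_cons x (w ++ [d])
          rw [ht] at hr
          exact absurd (List.cons.inj hr).1 hy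
        · refine ⟨s'', ?_⟩
          by_contra hne
          have he : e = d := by
            revert hne hy; cases e <;> cases d <;> cases x <;> simp
          subst he
          exact muL_ne_append_cons_cons hy _ s'' t (by rw [ht]; simp)
      obtain ⟨s'', rfl⟩ := hs'
      have := hp.2.2 s'' (x :: ((d :: t) ++ [x])) (by rw [ht]; simp)
        (by rw [List.reverse_cons, List.reverse_append, htp]; simp)
      rw [muL_cons_of_ne hy] at this
      simpa using this
  rw [hlps.palClosure_eq, muL_palClosure h]
  simp [muL_cons_of_ne hy]

theorem psi_append_singleton (v : List Bool) (y : Bool) :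
    psi (v ++ [y]) = palClosure (psi v ++ [y]) := by
  simp [psi]

/-- Justin's formula for the palindromization map. -/
theorem psi_cons (x : Bool) (v : List Bool) : psi (x :: v) = muL x (psi v) ++ [x] := by
  induction v using List.reverseRecOn with
  | nil => cases x <;> rfl
  | append_singleton v y ih =>
    rw [← List.cons_append, psi_append_singleton, psi_append_singleton, ih]
    rcases eq_or_ne y x with rfl | hy
    · rw [← palClosure_muL_append]
      simp [muL_cons_self]
    · rw [← palClosure_muL_of_ne hy]
      simp [muL_cons_of_ne hy]

theorem lamL_false : lamL false = muL false := by
  funext w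
  rw [lamL, muL]
  congr 1
  funext y
  cases y <;> rfl

theorem cons_lamL_true (w : List Bool) : true :: lamL true w = muL true w ++ [true] := by
  induction w with
  | nil => rfl
  | cons c w ih =>
    cases c
    · rw [muL_cons_of_ne (by decide), List.cons_append, List.cons_append, ← ih]; rfl
    · rw [muL_cons_self, List.cons_append, ← ih]; rfl

theorem lamL_injective (x : Bool) : Function.Injective (lamL x) := by
  cases x
  · rw [lamL_false]; exact muL_injective false
  · intro u v h
    have := congrArg (List.cons true) h
    rw [cons_lamL_true, cons_lamL_true] at this
    exact muL_injective true (List.append_cancel_right this)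

theorem lamL_append (x : Bool) (u v : List Bool) : lamL x (u ++ v) = lamL x u ++ lamL x v := by
  cases x <;> simp [lamL, applyM]

/-- The morphism `λ_x` maps the Christoffel word `aψ(u)b` to `aψ(xu)b`. -/
theorem lamL_christoffel (x : Bool) (u : List Bool) :
    lamL x (false :: (psi u ++ [true])) = false :: (psi (x :: u) ++ [true]) := by
  rw [psi_cons, ← List.singleton_append, lamL_append, lamL_append]
  cases x
  · rw [lamL_false]
    simp [muL, applyM]
  · rw [← cons_lamL_true]
    simp [lamL, applyM]

theorem lamL_true_ne (w t : List Bool) : lamL true w ≠ false :: false :: t := by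
  rcases w with _ | ⟨c, w⟩
  · simp [lamL, applyM]
  · cases c <;> simp [lamL, applyM]

theorem christoffel_of_lamL (x : Bool) (w : List Bool) (h : IsChristoffel (lamL x w)) :
    IsChristoffel w := by
  rcases h with h | h | ⟨v, h⟩
  · cases x
    · exact Or.inl (lamL_injective false (h.trans rfl))
    · rcases w with _ | ⟨c, w⟩
      · simp [lamL, applyM] at h
      · cases c <;> simp [lamL, applyM] at h
  · cases x
    · rcases w with _ | ⟨c, w⟩
      · simp [lamL, applyM] at h
      · cases c <;> simp [lamL, applyM] at h
    · exact Or.inr (Or.inl (lamL_injective true (h.trans rfl)))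
  · rcases v with _ | ⟨y, v⟩
    · cases x
      · exact Or.inr (Or.inl (lamL_injective false (h.trans rfl)))
      · exact Or.inl (lamL_injective true (h.trans rfl))
    · rcases eq_or_ne y x with rfl | hy
      · rw [← lamL_christoffel] at h
        exact Or.inr (Or.inr ⟨v, lamL_injective y h⟩)
      · rw [psi_cons] at h
        cases x
        · obtain rfl : y = true := by simpa using hy
          exact absurd h
            (by simpa [lamL_false] using
              muL_ne_append_cons_cons (by decide) w (false :: muL true (psi v)) [])
        · obtain rfl : y = false := by simpa using hy
          obtain ⟨t, ht⟩ := exists_muL_append_eq_cons false (psi v)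
          rw [ht] at h
          exact absurd h (lamL_true_ne w (t ++ [true]))

/-- if λ_v(w) is a Christoffel word then so is w. -/
theorem christoffel_of_lamW (v w : List Bool) (h : IsChristoffel (lamW v w)) :
    IsChristoffel w := by
  induction v with
  | nil => exact h
  | cons x v ih => exact ih (christoffel_of_lamL x _ h)

end Chri
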